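/- Let ξ = (ξ₁,…,ξ_T) be a stochastic process with values ξ_t ∈ ℝ^m, with distribution P on the path space (ℝ^m)^T supported on a compact set D = D₁×…×D_T, whose conditional probabilities P_t(A|x) := P(ξ_t ∈ A | (ξ₁,…,ξ_{t−1}) = x) satisfy the Lipschitz condition d_W(P_t(·|x), P_t(·|y)) ≤ γ_t‖x−y‖ for all x, y ∈ D and some constants γ_t > 0. Then for every ε > 0 there exists a finitely supported Borel probability measure P̃ on (ℝ^m)^T (the distribution of a process defined on a finite tree) such that nd(P, P̃) ≤ ε. -/

import Mathlib

open MeasureTheory ProbabilityTheory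
open scoped ENNReal NNReal

noncomputable section

/-- The Kantorovich–Wasserstein distance between two Borel probability measures on a
metric measurable space: the infimum of `∫ dist(x,y) dπ` over all couplings `π`. -/
def wdist {α : Type*} [MeasurableSpace α] [PseudoMetricSpace α]
    (μ ν : Measure α) : ℝ :=
  sInf { r | ∃ π : Measure (α × α), IsProbabilityMeasure π ∧
    π.map Prod.fst = μ ∧ π.map Prod.snd = ν ∧ r = ∫ z, dist z.1 z.2 ∂π }

/-- The path space `(ℝ^m)^T`. -/
abbrev PathSp (m T : ℕ) := Fin T → Fin m → ℝ

/-- Truncation of a path after stage `t` (1-based): coordinates `ξ_1, …, ξ_t` are kept,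
later coordinates are set to `0`. -/
def trunc {m T : ℕ} (t : ℕ) (ξ : PathSp m T) : PathSp m T :=
  fun s => if (s : ℕ) < t then ξ s else 0

/-- The canonical filtration on the path space: `𝔉_t` is the σ-algebra generated by the
first `t` coordinate projections. -/
def ftr (m T : ℕ) (t : ℕ) : MeasurableSpace (PathSp m T) :=
  MeasurableSpace.comap (trunc t) inferInstance

/-- The path distance `‖ξ − ξ̃‖ = Σ_t ‖ξ_t − ξ̃_t‖`. -/
def pathDist {m T : ℕ} (ξ ξ' : PathSp m T) : ℝ := ∑ t, dist (ξ t) (ξ' t)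

/-- A nested (bi-causal) coupling of two probability measures on the path space:
a coupling `π` such that, conditionally on `𝔉_t ⊗ 𝔉_t`, the first marginal reproduces
`P(·|𝔉_t)` and the second reproduces `P̃(·|𝔉_t)`, for every stage `t`. -/
def IsNestedCoupling {m T : ℕ} (P P' : Measure (PathSp m T))
    (π : Measure (PathSp m T × PathSp m T)) : Prop :=
  IsProbabilityMeasure π ∧ π.map Prod.fst = P ∧ π.map Prod.snd = P' ∧
  ∀ t, 1 ≤ t → t ≤ T → ∀ A : Set (PathSp m T), MeasurableSet A →
    (π[(A ×ˢ (Set.univ : Set (PathSp m T))).indicator (fun _ => (1 : ℝ)) |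
        (ftr m T t).prod (ftr m T t)]
      =ᵐ[π] fun z => (P[A.indicator (fun _ => (1 : ℝ)) | ftr m T t]) z.1) ∧
    (π[((Set.univ : Set (PathSp m T)) ×ˢ A).indicator (fun _ => (1 : ℝ)) |
        (ftr m T t).prod (ftr m T t)]
      =ᵐ[π] fun z => (P'[A.indicator (fun _ => (1 : ℝ)) | ftr m T t]) z.2)

/-- The nested (process) distance between two probability measures on the path space. -/
def nestedDist {m T : ℕ} (P P' : Measure (PathSp m T)) : ℝ :=
  sInf { r | ∃ π, IsNestedCoupling P P' π ∧ r = ∫ z, pathDist z.1 z.2 ∂π }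

/-- The conditional distribution `P_t(· | x)` of the `t`-th coordinate (0-based) given
that the first `t` coordinates equal `x`. -/
def condK {m T : ℕ} (P : Measure (PathSp m T)) [IsFiniteMeasure P]
    (t : ℕ) (ht : t < T) : Kernel (Fin t → Fin m → ℝ) (Fin m → ℝ) :=
  condDistrib (fun ξ => ξ ⟨t, ht⟩)
    (fun ξ (s : Fin t) => ξ ⟨(s : ℕ), lt_trans s.isLt ht⟩) P

section ConditionalExpectation

/-- A bounded `F`-measurable factor does not distinguish `f` from `P[f | F]` under the integral. -/
lemma integral_mul_condExp {Ω : Type*} {F mΩ : MeasurableSpace Ω} (hF : F ≤ mΩ) {P : Measure Ω}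
    [IsFiniteMeasure P] {Z f : Ω → ℝ} (hZ : Measurable[F] Z) {B : ℝ} (hB : ∀ x, |Z x| ≤ B)
    (hf : Integrable f P) : ∫ x, Z x * P[f | F] x ∂P = ∫ x, Z x * f x ∂P := by
  have hint : Integrable (Z * f) P :=
    hf.bdd_mul (hZ.mono hF le_rfl).aestronglyMeasurable (Filter.Eventually.of_forall hB)
  have h := condExp_mul_of_stronglyMeasurable_left (m := F) (μ := P) hZ.stronglyMeasurable hint hf
  calc ∫ x, Z x * P[f | F] x ∂P = ∫ x, P[Z * f | F] x ∂P :=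
        integral_congr_ae (h.mono fun x hx => by simp [hx])
    _ = ∫ x, Z x * f x ∂P := integral_condExp hF

/-- A conditional expectation given a product σ-algebra may be tested on rectangles. -/
lemma condExp_prod_ae_eq {X Y : Type*} {F mX : MeasurableSpace X} {G mY : MeasurableSpace Y}
    (hF : F ≤ mX) (hG : G ≤ mY) {π : Measure (X × Y)} [IsFiniteMeasure π] {f g : X × Y → ℝ}
    (hf : Integrable f π) (hg : Integrable g π) (hgm : Measurable[F.prod G] g)
    (h : ∀ S S', MeasurableSet[F] S → MeasurableSet[G] S' →
      ∫ z in S ×ˢ S', g z ∂π = ∫ z in S ×ˢ S', f z ∂π) :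
    π[f | F.prod G] =ᵐ[π] g := by
  have hle : F.prod G ≤ mX.prod mY :=
    sup_le_sup (MeasurableSpace.comap_mono hF) (MeasurableSpace.comap_mono hG)
  refine (ae_eq_condExp_of_forall_setIntegral_eq hle hf (fun s _ _ => hg.integrableOn) ?_
    hgm.stronglyMeasurable.aestronglyMeasurable).symm
  intro s hs _
  have huniv : ∫ z, g z ∂π = ∫ z, f z ∂π := by
    simpa using h Set.univ Set.univ MeasurableSet.univ MeasurableSet.univ
  refine MeasurableSpace.induction_on_inter
    (C := fun s _ => ∫ z in s, g z ∂π = ∫ z in s, f z ∂π)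
    (@generateFrom_prod X Y F G).symm (@isPiSystem_prod X Y F G) (by simp) ?_ ?_ ?_ s hs
  · rintro t ⟨S, hS, S', hS', rfl⟩
    exact h S S' hS hS'
  · intro t ht heq
    rw [setIntegral_compl (hle _ ht) hg, setIntegral_compl (hle _ ht) hf, heq, huniv]
  · intro u hd hu heq
    have h1 := hasSum_integral_iUnion (fun i => hle _ (hu i)) hd hg.integrableOn
    have h2 := hasSum_integral_iUnion (fun i => hle _ (hu i)) hd hf.integrableOn
    simp only [heq] at h1
    exact h1.unique h2

end ConditionalExpectation

section Coding

/-- A bounded random vector can be moved by at most `η` so that it takes finitely many nonzero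
values and encodes a given finite-valued random variable. -/
lemma exists_finite_range_code {Ω : Type*} {F : MeasurableSpace Ω} {m : ℕ} (i₀ : Fin m)
    {f : Ω → Fin m → ℝ} (hf : Measurable f) {R : ℝ} (hR : ∀ x i, |f x i| ≤ R)
    {g : Ω → ℕ} (hg : Measurable g) {n : ℕ} (hgn : ∀ x, g x < n) {η : ℝ} (hη : 0 < η) :
    ∃ (C : Ω → Fin m → ℝ) (h : (Fin m → ℝ) → ℕ), Measurable C ∧ Measurable h ∧
      (Set.range C).Finite ∧ (∀ x, C x ≠ 0) ∧ (∀ x, dist (C x) (f x) ≤ η) ∧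
      ∀ x, h (C x) = g x := by
  set φ : ℕ → ℝ := fun k => ((k : ℝ) + 1) / (n + 1) with hφ
  have hφpos : ∀ k, 0 < φ k := fun k => by positivity
  have hφlt : ∀ x, φ (g x) < 1 := fun x => by
    rw [hφ, div_lt_one (by positivity)]
    have : (g x : ℝ) < n := by exact_mod_cast hgn x
    linarith
  have hfract : ∀ x (z : ℤ), Int.fract ((z : ℝ) + φ (g x)) = φ (g x) := fun x z => by
    rw [Int.fract_intCast_add]
    exact Int.fract_eq_self.2 ⟨(hφpos _).le, hφlt x⟩
  refine ⟨fun x i => η * ((⌊f x i / η⌋ : ℝ) + φ (g x)),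
    fun c => ⌊Int.fract (c i₀ / η) * (n + 1)⌋₊ - 1, ?_, ?_, ?_, ?_, ?_, ?_⟩
  · refine measurable_pi_lambda _ fun i => ?_
    have h1 : Measurable fun x => (⌊f x i / η⌋ : ℝ) :=
      (Measurable.of_discrete (f := fun z : ℤ => (z : ℝ))).comp
        (((measurable_pi_apply i).comp hf).div_const η).floor
    have h2 : Measurable fun x => φ (g x) := (Measurable.of_discrete (f := φ)).comp hg
    exact (h1.add h2).const_mul η
  · have h1 : Measurable fun c : Fin m → ℝ => c i₀ := measurable_pi_apply i₀
    have h2 : Measurable fun c : Fin m → ℝ => Int.fract (c i₀ / η) * ((n : ℝ) + 1) :=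
      (measurable_fract.comp (h1.div_const η)).mul_const _
    exact (Measurable.of_discrete (f := fun k : ℕ => k - 1)).comp (Nat.measurable_floor.comp h2)
  · have hfin : ((Set.univ.pi fun _ : Fin m => Set.Icc (⌊-R / η⌋) (⌊R / η⌋)) ×ˢ
        Set.Iio n).Finite := (Set.Finite.pi fun _ => Set.finite_Icc _ _).prod (Set.finite_Iio n)
    refine (hfin.image fun p : (Fin m → ℤ) × ℕ => fun i => η * ((p.1 i : ℝ) + φ p.2)).subset ?_
    rintro _ ⟨x, rfl⟩
    refine ⟨(fun i => ⌊f x i / η⌋, g x), ⟨fun i _ => ?_, hgn x⟩, rfl⟩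
    have := abs_le.1 (hR x i)
    exact ⟨Int.floor_mono (by gcongr; exact this.1), Int.floor_mono (by gcongr; exact this.2)⟩
  · intro x h0
    have h1 := congrFun h0 i₀
    have h2 : ((⌊f x i₀ / η⌋ : ℝ) + φ (g x)) = 0 := by
      simpa [hη.ne'] using h1
    have h3 := hfract x ⌊f x i₀ / η⌋
    rw [h2, Int.fract_zero] at h3
    exact (hφpos (g x)).ne h3
  · intro x
    refine (dist_pi_le_iff hη.le).2 fun i => ?_
    have h1 : f x i = η * ((⌊f x i / η⌋ : ℝ) + Int.fract (f x i / η)) := by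
      rw [Int.floor_add_fract]; field_simp
    rw [Real.dist_eq]
    have h2 : η * ((⌊f x i / η⌋ : ℝ) + φ (g x)) - f x i
        = η * (φ (g x) - Int.fract (f x i / η)) := by linear_combination -h1
    rw [h2, abs_mul, abs_of_pos hη]
    refine mul_le_of_le_one_right hη.le (abs_le.2 ⟨?_, ?_⟩)
    · linarith [hφpos (g x), Int.fract_lt_one (f x i / η)]
    · linarith [hφlt x, Int.fract_nonneg (f x i / η)]
  · intro x
    have h1 : φ (g x) * (n + 1) = ((g x + 1 : ℕ) : ℝ) := by
      rw [hφ]; push_cast; field_simp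
    simp only [mul_div_cancel_left₀ _ hη.ne']
    rw [hfract, h1, Nat.floor_natCast]
    simp

/-- Given a finite-valued `C'`, the vector `f` can be coded by a finite-valued `F`-measurable `C`
such that, after thinning `C'` by an acceptance probability `θ` close to `1`, the conditional law
of `C'` given `F` is a function of `C` alone. -/
lemma exists_code_thinning {Ω : Type*} {F F' mΩ : MeasurableSpace Ω} (hF : F ≤ mΩ)
    (P : Measure Ω) [IsProbabilityMeasure P] {m : ℕ} (i₀ : Fin m)
    {f : Ω → Fin m → ℝ} (hf : Measurable[F] f) {R : ℝ} (hR : ∀ x i, |f x i| ≤ R)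
    (hFF' : F ≤ F') (hF' : F' ≤ mΩ)
    {C' : Ω → Fin m → ℝ} (hC' : Measurable[F'] C') (hfin : (Set.range C').Finite)
    {η δ : ℝ} (hη : 0 < η) (hδ : 0 < δ) :
    ∃ (C : Ω → Fin m → ℝ) (θ : Ω → ℝ) (r : (Fin m → ℝ) → (Fin m → ℝ) → ℝ),
      Measurable[F] C ∧ (Set.range C).Finite ∧ (∀ x, C x ≠ 0) ∧ (∀ x, dist (C x) (f x) ≤ η) ∧
      Measurable[F'] θ ∧ (∀ x, 0 ≤ θ x) ∧ (∀ x, θ x ≤ 1) ∧ 1 - δ ≤ ∫ x, θ x ∂P ∧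
      (∀ k, Measurable (r k)) ∧ (∀ k c, |r k c| ≤ 1) ∧
      ∀ k ∈ Set.range C', P[(C' ⁻¹' {k}).indicator θ | F] =ᵐ[P] fun x => r k (C x) := by
  classical
  set K : Finset (Fin m → ℝ) := hfin.toFinset with hK
  have hCK : ∀ x, C' x ∈ K := fun x => by simp [hK]
  obtain ⟨N, hN⟩ := exists_nat_gt ((K.card : ℝ) / δ)
  have hN0 : (0 : ℝ) < N := lt_of_le_of_lt (by positivity) hN
  have hKN : (K.card : ℝ) / N ≤ δ := by
    rw [div_lt_iff₀ hδ] at hN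
    rw [div_le_iff₀ hN0]; linarith
  set I : (Fin m → ℝ) → Ω → ℝ := fun k => (C' ⁻¹' {k}).indicator fun _ => 1 with hI
  have hCset : ∀ k, MeasurableSet[F'] (C' ⁻¹' {k}) := fun k => hC' (measurableSet_singleton k)
  have hIint : ∀ k, Integrable (I k) P := fun k =>
    (integrable_const (1 : ℝ)).indicator (hF' _ (hCset k))
  set q : (Fin m → ℝ) → Ω → ℝ := fun k => P[I k | F] with hq
  have hqm : ∀ k, Measurable[F] (q k) := fun k => stronglyMeasurable_condExp.measurable
  set a : (Fin m → ℝ) → Ω → ℕ := fun k x => min ⌊N * q k x⌋₊ N with ha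
  have ham : ∀ k, Measurable[F] (a k) := fun k =>
    (Measurable.of_discrete (f := fun j : ℕ => min j N)).comp
      (Nat.measurable_floor.comp ((hqm k).const_mul _))
  set ρ : (Fin m → ℝ) → Ω → ℝ := fun k x => (a k x : ℝ) / N with hρ
  have hρm : ∀ k, Measurable[F] (ρ k) := fun k =>
    ((Measurable.of_discrete (f := fun j : ℕ => (j : ℝ))).comp (ham k)).div_const _
  have hρ0 : ∀ k x, 0 ≤ ρ k x := fun k x => by positivity
  have hρ1 : ∀ k x, ρ k x ≤ 1 := fun k x => by
    rw [hρ, div_le_one hN0]; exact_mod_cast min_le_right _ _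
  have hρq : ∀ k x, 0 ≤ q k x → ρ k x ≤ q k x := fun k x h => by
    rw [hρ, div_le_iff₀ hN0, mul_comm]
    exact (Nat.cast_le.2 (min_le_left _ _)).trans (Nat.floor_le (by positivity))
  have hρz : ∀ k x, q k x ≤ 0 → ρ k x = 0 := fun k x h => by
    have : ⌊N * q k x⌋₊ = 0 := Nat.floor_of_nonpos (mul_nonpos_of_nonneg_of_nonpos hN0.le h)
    simp [hρ, ha, this]
  have hqle : ∀ k, ∀ᵐ x ∂P, q k x - 1 / N ≤ ρ k x := fun k => by
    have h1 : P[I k | F] ≤ᵐ[P] P[fun _ => (1 : ℝ) | F] :=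
      condExp_mono (hIint k) (integrable_const _) (Filter.Eventually.of_forall fun x =>
        Set.indicator_le_self' (fun _ _ => zero_le_one) x)
    rw [condExp_const hF] at h1
    filter_upwards [h1] with x hx
    have hx' : q k x ≤ 1 := hx
    have h2 := Nat.lt_floor_add_one (N * q k x)
    rw [hρ, le_div_iff₀ hN0, sub_mul, one_div_mul_cancel hN0.ne', ha]
    push_cast
    refine le_min (by linarith) (by nlinarith)
  set w : (Fin m → ℝ) → Ω → ℝ := fun k x => ρ k x / q k x with hw
  have hwm : ∀ k, Measurable[F] (w k) := fun k => (hρm k).div (hqm k)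
  have hw0 : ∀ k x, 0 ≤ w k x := fun k x => by
    rcases le_or_gt (q k x) 0 with h | h
    · simp [hw, hρz k x h]
    · exact div_nonneg (hρ0 k x) h.le
  have hw1 : ∀ k x, w k x ≤ 1 := fun k x => by
    rcases le_or_gt (q k x) 0 with h | h
    · simp [hw, hρz k x h]
    · exact (div_le_one h).2 (hρq k x h.le)
  have hwabs : ∀ k x, |w k x| ≤ 1 := fun k x => abs_le.2 ⟨by linarith [hw0 k x], hw1 k x⟩
  have hwq : ∀ k x, w k x * q k x = ρ k x := fun k x => by
    rcases eq_or_ne (q k x) 0 with h | h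
    · simp [h, hρz k x h.le]
    · exact div_mul_cancel₀ _ h
  set θ : Ω → ℝ := fun x => ∑ k ∈ K, w k x * I k x with hθ
  have hθeq : ∀ x, θ x = w (C' x) x := fun x => by
    rw [hθ]
    simp only [hI]
    rw [Finset.sum_eq_single_of_mem (C' x) (hCK x)]
    · simp
    · intro k _ hk
      simp [Ne.symm hk]
  have hθI : ∀ k, (C' ⁻¹' {k}).indicator θ = w k * I k := fun k => by
    ext x
    by_cases hx : C' x = k
    · simp [hI, hx, hθeq]
    · simp [hI, hx]
  have hwI : ∀ k, Integrable (w k * I k) P := fun k =>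
    (hIint k).bdd_mul ((hwm k).mono hF le_rfl).aestronglyMeasurable
      (Filter.Eventually.of_forall (hwabs k))
  have hcond : ∀ k, P[(C' ⁻¹' {k}).indicator θ | F] =ᵐ[P] ρ k := fun k => by
    rw [hθI]
    filter_upwards [condExp_mul_of_stronglyMeasurable_left (m := F) (hwm k).stronglyMeasurable
      (hwI k) (hIint k)] with x hx
    rw [hx]
    exact hwq k x
  have hρint : ∀ k, Integrable (ρ k) P := fun k =>
    Integrable.of_bound ((hρm k).mono hF le_rfl).aestronglyMeasurable 1
      (Filter.Eventually.of_forall fun x => by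
        rw [Real.norm_eq_abs, abs_of_nonneg (hρ0 k x)]; exact hρ1 k x)
  have hθint : 1 - δ ≤ ∫ x, θ x ∂P := by
    have h1 : ∫ x, θ x ∂P = ∑ k ∈ K, ∫ x, ρ k x ∂P := by
      refine (integral_finsetSum K fun k _ => hwI k).trans ?_
      refine Finset.sum_congr rfl fun k _ => ?_
      have h2 := hcond k
      rw [hθI] at h2
      rw [← integral_congr_ae h2, integral_condExp hF]
    have h2 : ∑ k ∈ K, ∫ x, q k x ∂P = 1 := by
      have h3 : ∀ k, ∫ x, q k x ∂P = ∫ x, I k x ∂P := fun k => integral_condExp hF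
      simp only [h3]
      rw [← integral_finsetSum K fun k _ => hIint k]
      have h4 : ∀ x, ∑ k ∈ K, I k x = 1 := fun x => by
        rw [Finset.sum_eq_single_of_mem (C' x) (hCK x)]
        · simp [hI]
        · intro k _ hk
          simp [hI, Ne.symm hk]
      simp [h4]
    have h3 : ∀ k, ∫ x, q k x ∂P - 1 / N ≤ ∫ x, ρ k x ∂P := fun k => by
      have h4 : ∫ x, (q k x - 1 / N) ∂P ≤ ∫ x, ρ k x ∂P :=
        integral_mono_ae (integrable_condExp.sub (integrable_const _)) (hρint k) (hqle k)
      rw [integral_sub integrable_condExp (integrable_const _)] at h4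
      simpa using h4
    have h4 := Finset.sum_le_sum fun k (_ : k ∈ K) => h3 k
    rw [Finset.sum_sub_distrib, h2, Finset.sum_const, nsmul_eq_mul, mul_one_div] at h4
    rw [h1]; linarith
  have hlt : ∀ k x, a k x < N + 1 := fun k x => Nat.lt_succ_of_le (min_le_right _ _)
  set e := Fintype.equivFin (K → Fin (N + 1)) with he
  set g : Ω → ℕ := fun x => e fun k => ⟨a k x, hlt k x⟩ with hg
  have hgm : Measurable[F] g := by
    have h1 : Measurable[F] fun x => fun k : K => (⟨a k x, hlt k x⟩ : Fin (N + 1)) := by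
      refine (@measurable_pi_iff Ω K (fun _ => Fin (N + 1)) F _ _).2 fun k => ?_
      have h2 := (Measurable.of_discrete (f := fun j : ℕ => Fin.ofNat (N + 1) j)).comp (ham k)
      convert h2 using 2 with x
      ext
      simp [Nat.mod_eq_of_lt (hlt k x)]
    exact (Measurable.of_discrete (f := fun v => ((e v : Fin _) : ℕ))).comp h1
  obtain ⟨C, h, hCm, hhm, hCfin, hC0, hCf, hhC⟩ :=
    exists_finite_range_code i₀ hf hR hgm (fun x => (e _).isLt) hη
  set dec : (Fin m → ℝ) → ℕ → ℝ := fun k j =>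
    if hj : j < Fintype.card (K → Fin (N + 1)) then
      if hk : k ∈ K then ((e.symm ⟨j, hj⟩ ⟨k, hk⟩ : ℕ) : ℝ) / N else 0
    else 0 with hdec
  refine ⟨C, θ, fun k c => dec k (h c), hCm, hCfin, hC0, hCf, ?_, ?_, ?_, hθint, ?_, ?_, ?_⟩
  · refine Finset.measurable_fun_sum K fun k _ => ((hwm k).mono hFF' le_rfl).mul ?_
    exact measurable_const.indicator (hCset k)
  · intro x; rw [hθeq]; exact hw0 _ _
  · intro x; rw [hθeq]; exact hw1 _ _
  · exact fun k => (Measurable.of_discrete (f := dec k)).comp hhm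
  · intro k c
    simp only [hdec]
    split_ifs with hj hk
    · rw [abs_of_nonneg (by positivity), div_le_one hN0]
      exact_mod_cast Nat.lt_succ_iff.1 (e.symm ⟨h c, hj⟩ ⟨k, hk⟩).isLt
    · simp
    · simp
  · intro k hk
    have hk' : k ∈ K := by simpa [hK] using hk
    filter_upwards [hcond k] with x hx
    rw [hx, hhC]
    have hj : g x < Fintype.card (K → Fin (N + 1)) := (e _).isLt
    simp only [hdec]
    rw [dif_pos hj, dif_pos hk']
    simp [hg, hρ]

end Coding

section Truncation

variable {m T : ℕ}

lemma measurable_trunc (t : ℕ) : Measurable (trunc t : PathSp m T → PathSp m T) := by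
  refine measurable_pi_iff.2 fun s => ?_
  by_cases h : (s : ℕ) < t
  · simpa [trunc, h] using measurable_pi_apply s
  · simp [trunc, h]

lemma trunc_trunc (s t : ℕ) (x : PathSp m T) : trunc s (trunc t x) = trunc (min s t) x := by
  ext i
  by_cases h1 : (i : ℕ) < s <;> by_cases h2 : (i : ℕ) < t <;> simp [trunc, h1, h2]

lemma trunc_eq_self {t : ℕ} (h : T ≤ t) (x : PathSp m T) : trunc t x = x := by
  ext i
  simp [trunc, i.isLt.trans_le h]

lemma trunc_succ {t : ℕ} (h : t < T) (x : PathSp m T) :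
    trunc (t + 1) x = Function.update (trunc t x) ⟨t, h⟩ (x ⟨t, h⟩) := by
  funext i
  by_cases hi : i = ⟨t, h⟩
  · subst hi; simp [trunc]
  · have : (i : ℕ) ≠ t := fun h' => hi (Fin.ext h')
    rw [Function.update_of_ne hi]
    have h3 : (i : ℕ) < t + 1 ↔ (i : ℕ) < t := by omega
    simp [trunc, h3]

lemma ftr_le (t : ℕ) : ftr m T t ≤ (inferInstance : MeasurableSpace (PathSp m T)) :=
  (measurable_trunc t).comap_le

lemma measurable_ftr_trunc (t : ℕ) :
    Measurable[ftr m T t] (trunc t : PathSp m T → PathSp m T) :=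
  comap_measurable _

lemma ftr_mono {s t : ℕ} (h : s ≤ t) : ftr m T s ≤ ftr m T t := by
  have h1 : (trunc s : PathSp m T → PathSp m T) = trunc s ∘ trunc t := by
    funext x; simp [trunc_trunc, h]
  rw [ftr, h1, ← MeasurableSpace.comap_comp]
  exact MeasurableSpace.comap_mono (measurable_trunc s).comap_le

lemma trunc_mem_iff {t s : ℕ} (h : t ≤ s) {S : Set (PathSp m T)} (hS : MeasurableSet[ftr m T t] S)
    (x : PathSp m T) : trunc s x ∈ S ↔ x ∈ S := by
  obtain ⟨S', -, rfl⟩ := hS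
  simp [trunc_trunc, h]

lemma measurable_ftr_apply {t : ℕ} (s : Fin T) (h : (s : ℕ) < t) :
    Measurable[ftr m T t] fun x : PathSp m T => x s := by
  have h1 : (fun x : PathSp m T => x s) = fun x => trunc t x s := by
    funext x; simp [trunc, h]
  rw [h1]
  exact (measurable_pi_apply s).comp (measurable_ftr_trunc t)

end Truncation

section StoppedCoupling

variable {m T : ℕ}

/-- Probability that the first `t` stages are accepted, given the path. -/
def survival (θ : ℕ → PathSp m T → ℝ) (t : ℕ) (x : PathSp m T) : ℝ :=
  ∏ s ∈ Finset.range t, θ s x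

/-- Probability that stage `j` is the first one to be rejected, given the path. -/
def stopWeight (θ : ℕ → PathSp m T → ℝ) (j : ℕ) (x : PathSp m T) : ℝ :=
  survival θ j x * (1 - θ j x)

/-- The path of codes `C₀, …, C_{T-1}`. -/
def codePath (C : ℕ → PathSp m T → Fin m → ℝ) (x : PathSp m T) : PathSp m T := fun s => C s x

/-- The joint law of a path and of its code path set to `0` from the first rejected stage on. -/
def stoppedCoupling (P : Measure (PathSp m T)) (C : ℕ → PathSp m T → Fin m → ℝ)
    (θ : ℕ → PathSp m T → ℝ) : Measure (PathSp m T × PathSp m T) :=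
  ∑ j ∈ Finset.range (T + 1), (P.withDensity fun x => ENNReal.ofReal (stopWeight θ j x)).map
    fun x => (x, trunc j (codePath C x))

/-- Adapted nonzero finite-valued codes `C` with adapted acceptance probabilities `θ`, such that
the law of the next accepted code given the past is a function of the current code. -/
structure IsThinnedCode (P : Measure (PathSp m T)) (C : ℕ → PathSp m T → Fin m → ℝ)
    (θ : ℕ → PathSp m T → ℝ) : Prop where
  measurable_code : ∀ t, Measurable[ftr m T (t + 1)] (C t)
  finite_range : ∀ t, (Set.range (C t)).Finite
  code_ne_zero : ∀ t < T, ∀ x, C t x ≠ 0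
  measurable_accept : ∀ t, Measurable[ftr m T (t + 1)] (θ t)
  nonneg : ∀ t x, 0 ≤ θ t x
  le_one : ∀ t x, θ t x ≤ 1
  accept_last : ∀ x, θ T x = 0
  transition : ∀ t, t + 1 < T → ∃ r : (Fin m → ℝ) → (Fin m → ℝ) → ℝ,
    (∀ k, Measurable (r k)) ∧ (∀ k c, |r k c| ≤ 1) ∧
    ∀ k ∈ Set.range (C (t + 1)),
      P[(C (t + 1) ⁻¹' {k}).indicator (θ (t + 1)) | ftr m T (t + 1)] =ᵐ[P] fun x => r k (C t x)

lemma sum_Ico_stopWeight (θ : ℕ → PathSp m T → ℝ) (x : PathSp m T) {t n : ℕ} (h : t ≤ n) :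
    ∑ j ∈ Finset.Ico t n, stopWeight θ j x = survival θ t x - survival θ n x := by
  induction n, h using Nat.le_induction with
  | base => simp
  | succ n hn ih =>
    rw [Finset.sum_Ico_succ_top hn, ih, survival, survival, survival, stopWeight, survival,
      Finset.prod_range_succ]
    ring

namespace IsThinnedCode

variable {P : Measure (PathSp m T)}
  {C : ℕ → PathSp m T → Fin m → ℝ} {θ : ℕ → PathSp m T → ℝ}

lemma survival_nonneg (H : IsThinnedCode P C θ) (t : ℕ) (x : PathSp m T) : 0 ≤ survival θ t x :=
  Finset.prod_nonneg fun s _ => H.nonneg s x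

lemma survival_le_one (H : IsThinnedCode P C θ) (t : ℕ) (x : PathSp m T) : survival θ t x ≤ 1 :=
  Finset.prod_le_one (fun s _ => H.nonneg s x) fun s _ => H.le_one s x

lemma one_sub_survival_le (H : IsThinnedCode P C θ) (t : ℕ) (x : PathSp m T) :
    1 - survival θ t x ≤ ∑ s ∈ Finset.range t, (1 - θ s x) := by
  induction t with
  | zero => simp [survival]
  | succ t ih =>
    have h1 : survival θ (t + 1) x = survival θ t x * θ t x := Finset.prod_range_succ _ _
    rw [Finset.sum_range_succ, h1]
    nlinarith [H.survival_nonneg t x, H.survival_le_one t x, H.nonneg t x, H.le_one t x]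

lemma stopWeight_nonneg (H : IsThinnedCode P C θ) (t : ℕ) (x : PathSp m T) :
    0 ≤ stopWeight θ t x :=
  mul_nonneg (H.survival_nonneg t x) (by linarith [H.le_one t x])

lemma stopWeight_le_one (H : IsThinnedCode P C θ) (t : ℕ) (x : PathSp m T) :
    stopWeight θ t x ≤ 1 :=
  mul_le_one₀ (H.survival_le_one t x) (by linarith [H.le_one t x]) (by linarith [H.nonneg t x])

lemma measurable_survival (H : IsThinnedCode P C θ) (t : ℕ) :
    Measurable[ftr m T t] (survival θ t) :=
  Finset.measurable_fun_prod _ fun s hs =>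
    (H.measurable_accept s).mono (ftr_mono (Finset.mem_range.1 hs)) le_rfl

lemma measurable_stopWeight (H : IsThinnedCode P C θ) {j t : ℕ} (h : j < t) :
    Measurable[ftr m T t] (stopWeight θ j) :=
  ((H.measurable_survival j).mono (ftr_mono h.le) le_rfl).mul
    (((H.measurable_accept j).mono (ftr_mono h) le_rfl).const_sub 1)

lemma measurable_trunc_codePath (H : IsThinnedCode P C θ) {j t : ℕ} (h : j ≤ t) :
    Measurable[ftr m T t] fun x => trunc j (codePath C x) := by
  refine (@measurable_pi_iff _ _ _ (ftr m T t) _ _).2 fun s => ?_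
  by_cases hs : (s : ℕ) < j
  · simpa [trunc, hs, codePath] using
      (H.measurable_code s).mono (ftr_mono (show (s : ℕ) + 1 ≤ t by omega)) le_rfl
  · simp [trunc, hs]

lemma measurable_graph (H : IsThinnedCode P C θ) (j : ℕ) :
    Measurable fun x => (x, trunc j (codePath C x)) :=
  measurable_id.prodMk ((H.measurable_trunc_codePath le_rfl).mono (ftr_le j) le_rfl)

lemma sum_range_stopWeight (H : IsThinnedCode P C θ) {t : ℕ} (h : t ≤ T) (x : PathSp m T) :
    ∑ j ∈ Finset.Ico t (T + 1), stopWeight θ j x = survival θ t x := by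
  rw [sum_Ico_stopWeight θ x (by omega), survival, survival, Finset.prod_range_succ _ T,
    H.accept_last]
  simp

lemma integrable_weight_mul {w f : PathSp m T → ℝ} (hw : Measurable w) (h0 : ∀ x, 0 ≤ w x)
    (h1 : ∀ x, w x ≤ 1) (hf : Integrable f P) : Integrable (fun x => w x * f x) P :=
  hf.bdd_mul (c := 1) hw.aestronglyMeasurable
    (Filter.Eventually.of_forall fun x => by
      rw [Real.norm_eq_abs, abs_of_nonneg (h0 x)]; exact h1 x)

lemma integral_stoppedCoupling (H : IsThinnedCode P C θ) {Φ : PathSp m T × PathSp m T → ℝ}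
    (hΦ : Measurable Φ) (hint : ∀ j, Integrable (fun x => Φ (x, trunc j (codePath C x))) P) :
    Integrable Φ (stoppedCoupling P C θ) ∧ ∫ z, Φ z ∂(stoppedCoupling P C θ) =
      ∑ j ∈ Finset.range (T + 1),
        ∫ x, stopWeight θ j x * Φ (x, trunc j (codePath C x)) ∂P := by
  have hwm : ∀ j, Measurable (stopWeight θ j) := fun j =>
    (H.measurable_stopWeight (Nat.lt_succ_self j)).mono (ftr_le _) le_rfl
  have hlt : ∀ j, ∀ᵐ x ∂P, ENNReal.ofReal (stopWeight θ j x) < ⊤ := fun j =>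
    Filter.Eventually.of_forall fun x => ENNReal.ofReal_lt_top
  have hI : ∀ j ∈ Finset.range (T + 1), Integrable Φ
      ((P.withDensity fun x => ENNReal.ofReal (stopWeight θ j x)).map
        fun x => (x, trunc j (codePath C x))) := fun j _ => by
    rw [integrable_map_measure hΦ.aestronglyMeasurable (H.measurable_graph j).aemeasurable,
      integrable_withDensity_iff_integrable_smul' (hwm j).ennreal_ofReal (hlt j)]
    simp only [ENNReal.toReal_ofReal (H.stopWeight_nonneg j _)]
    exact integrable_weight_mul (hwm j) (H.stopWeight_nonneg j) (H.stopWeight_le_one j) (hint j)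
  refine ⟨integrable_finsetSum_measure.2 hI, ?_⟩
  rw [stoppedCoupling, integral_finsetSum_measure hI]
  refine Finset.sum_congr rfl fun j _ => ?_
  rw [integral_map (H.measurable_graph j).aemeasurable hΦ.aestronglyMeasurable,
    integral_withDensity_eq_integral_toReal_smul (hwm j).ennreal_ofReal (hlt j)]
  simp only [ENNReal.toReal_ofReal (H.stopWeight_nonneg j _), smul_eq_mul]

/-- If the integrand only depends on the code up to stage `t`, all later stopping times
contribute together with the weight `survival θ t`. -/
lemma integral_stoppedCoupling_of_trunc (H : IsThinnedCode P C θ) {t : ℕ} (ht : t ≤ T)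
    {Φ : PathSp m T × PathSp m T → ℝ} (hΦ : Measurable Φ)
    (hint : ∀ j, Integrable (fun x => Φ (x, trunc j (codePath C x))) P)
    (htr : ∀ x y, Φ (x, trunc t y) = Φ (x, y)) :
    ∫ z, Φ z ∂(stoppedCoupling P C θ) =
      ∑ j ∈ Finset.range t, ∫ x, stopWeight θ j x * Φ (x, trunc j (codePath C x)) ∂P +
        ∫ x, survival θ t x * Φ (x, trunc t (codePath C x)) ∂P := by
  rw [(H.integral_stoppedCoupling hΦ hint).2,
    ← Finset.sum_range_add_sum_Ico _ (show t ≤ T + 1 by omega)]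
  congr 1
  have h1 : ∀ j ∈ Finset.Ico t (T + 1), ∀ x,
      Φ (x, trunc j (codePath C x)) = Φ (x, trunc t (codePath C x)) := fun j hj x => by
    rw [← htr, trunc_trunc, min_eq_left (Finset.mem_Ico.1 hj).1]
  rw [← integral_finsetSum]
  · refine integral_congr_ae (Filter.Eventually.of_forall fun x => ?_)
    simp only
    rw [← H.sum_range_stopWeight ht, Finset.sum_mul]
    exact Finset.sum_congr rfl fun j hj => by rw [h1 j hj]
  · exact fun j _ => integrable_weight_mul
      ((H.measurable_stopWeight (Nat.lt_succ_self j)).mono (ftr_le _) le_rfl)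
      (H.stopWeight_nonneg j) (H.stopWeight_le_one j) (hint j)

lemma map_fst_stoppedCoupling (H : IsThinnedCode P C θ) :
    (stoppedCoupling P C θ).map Prod.fst = P := by
  have hwm : ∀ j, Measurable (stopWeight θ j) := fun j =>
    (H.measurable_stopWeight (Nat.lt_succ_self j)).mono (ftr_le _) le_rfl
  ext A hA
  rw [stoppedCoupling, Measure.map_apply measurable_fst hA, Measure.finsetSum_apply]
  have h1 : ∀ j, ((P.withDensity fun x => ENNReal.ofReal (stopWeight θ j x)).map
      fun x => (x, trunc j (codePath C x))) (Prod.fst ⁻¹' A) =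
      ∫⁻ x in A, ENNReal.ofReal (stopWeight θ j x) ∂P := fun j => by
    rw [Measure.map_apply (H.measurable_graph j) (measurable_fst hA)]
    exact withDensity_apply _ hA
  simp only [h1]
  rw [← lintegral_finsetSum _ fun j _ => (hwm j).ennreal_ofReal]
  have h2 : ∀ x, ∑ j ∈ Finset.range (T + 1), ENNReal.ofReal (stopWeight θ j x) = 1 := fun x => by
    rw [← ENNReal.ofReal_sum_of_nonneg fun j _ => H.stopWeight_nonneg j x, Finset.range_eq_Ico,
      H.sum_range_stopWeight (Nat.zero_le T)]
    simp [survival]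
  simp [h2]

lemma exists_finset_map_snd_stoppedCoupling (H : IsThinnedCode P C θ) :
    ∃ s : Finset (PathSp m T), (stoppedCoupling P C θ).map Prod.snd (↑s)ᶜ = 0 := by
  have hfin : (Set.range (codePath C)).Finite :=
    (Set.Finite.pi fun s : Fin T => H.finite_range s).subset (by
      rintro _ ⟨x, rfl⟩ s -
      exact ⟨x, rfl⟩)
  have hfin' : (⋃ j ∈ Finset.range (T + 1), trunc j '' Set.range (codePath C)).Finite :=
    (Finset.range (T + 1)).finite_toSet.biUnion fun j _ => hfin.image _
  refine ⟨hfin'.toFinset, ?_⟩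
  have hm := hfin'.toFinset.measurableSet.compl
  rw [Measure.map_apply measurable_snd hm, stoppedCoupling, Measure.finsetSum_apply]
  refine Finset.sum_eq_zero fun j hj => ?_
  rw [Measure.map_apply (H.measurable_graph j) (measurable_snd hm)]
  convert measure_empty (μ := P.withDensity fun x => ENNReal.ofReal (stopWeight θ j x))
  refine Set.eq_empty_of_forall_notMem fun x hx => hx ?_
  simp only [Set.Finite.coe_toFinset, Set.mem_iUnion]
  exact ⟨j, hj, codePath C x, ⟨x, rfl⟩, rfl⟩

variable [IsProbabilityMeasure P]

lemma isProbabilityMeasure_stoppedCoupling (H : IsThinnedCode P C θ) :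
    IsProbabilityMeasure (stoppedCoupling P C θ) := by
  constructor
  have h := congrArg (fun μ : Measure (PathSp m T) => μ Set.univ) H.map_fst_stoppedCoupling
  simpa [Measure.map_apply measurable_fst MeasurableSet.univ] using h

/-- The coupling is causal from the path to the code. -/
lemma condExp_fst_stoppedCoupling (H : IsThinnedCode P C θ) {t : ℕ} (ht : t ≤ T)
    {A : Set (PathSp m T)} (hA : MeasurableSet A) :
    (stoppedCoupling P C θ)[(A ×ˢ (Set.univ : Set (PathSp m T))).indicator (fun _ => (1 : ℝ)) |
        (ftr m T t).prod (ftr m T t)]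
      =ᵐ[stoppedCoupling P C θ]
        fun z => (P[A.indicator (fun _ => (1 : ℝ)) | ftr m T t]) z.1 := by
  have := H.isProbabilityMeasure_stoppedCoupling
  set a : PathSp m T → ℝ := A.indicator fun _ => 1 with ha
  have ham : Measurable a := measurable_const.indicator hA
  have hai : Integrable a P := (integrable_const (1 : ℝ)).indicator hA
  have hcm : Measurable[ftr m T t] (P[a | ftr m T t]) := stronglyMeasurable_condExp.measurable
  have hcm' : Measurable (P[a | ftr m T t]) := hcm.mono (ftr_le t) le_rfl
  have hfst : (A ×ˢ (Set.univ : Set (PathSp m T))).indicator (fun _ => (1 : ℝ))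
      = fun z => a z.1 := by
    ext z
    by_cases hz : z.1 ∈ A <;> simp [ha, hz]
  have hint : ∀ b : PathSp m T → ℝ, Measurable b → Integrable b P →
      Integrable (fun z : PathSp m T × PathSp m T => b z.1) (stoppedCoupling P C θ) :=
    fun b hb hbi => (H.integral_stoppedCoupling (hb.comp measurable_fst) fun _ => hbi).1
  rw [hfst]
  refine condExp_prod_ae_eq (ftr_le t) (ftr_le t) (hint a ham hai)
    (hint _ hcm' integrable_condExp) (hcm.comp (@measurable_fst _ _ (ftr m T t) (ftr m T t))) ?_
  intro S S' hS hS'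
  have hSm := ftr_le t _ hS
  have hSm' := ftr_le t _ hS'
  set χ : ℕ → PathSp m T → ℝ := fun j x =>
    (S ×ˢ S').indicator (fun _ => 1) (x, trunc j (codePath C x)) with hχ
  have hχ0 : ∀ j x, 0 ≤ χ j x := fun j x => Set.indicator_nonneg (fun _ _ => zero_le_one) _
  have hχ1 : ∀ j x, χ j x ≤ 1 := fun j x => Set.indicator_le_self' (fun _ _ => zero_le_one) _
  have hχm : ∀ j ≤ t, Measurable[ftr m T t] (χ j) := fun j hj => by
    have h1 : MeasurableSet[ftr m T t] (S ∩ (fun x => trunc j (codePath C x)) ⁻¹' S') := by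
      refine hS.inter ?_
      obtain ⟨S'', hS'', rfl⟩ := hS'
      exact (measurable_trunc t).comp (H.measurable_trunc_codePath le_rfl |>.mono
        (ftr_mono hj) le_rfl) hS''
    exact (measurable_const (a := (1 : ℝ))).indicator h1
  set W : PathSp m T → ℝ := fun x =>
    ∑ j ∈ Finset.range t, stopWeight θ j x * χ j x + survival θ t x * χ t x with hW
  have hWm : Measurable[ftr m T t] W := by
    refine Measurable.add (Finset.measurable_fun_sum _ fun j hj => ?_)
      ((H.measurable_survival t).mul (hχm t le_rfl))
    have hj' := Finset.mem_range.1 hj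
    exact (H.measurable_stopWeight hj').mul (hχm j hj'.le)
  have hWb : ∀ x, |W x| ≤ ∑ j ∈ Finset.range t, (1 : ℝ) + 1 := fun x => by
    rw [abs_of_nonneg]
    · exact add_le_add (Finset.sum_le_sum fun j _ =>
        mul_le_one₀ (H.stopWeight_le_one j x) (hχ0 j x) (hχ1 j x))
        (mul_le_one₀ (H.survival_le_one t x) (hχ0 t x) (hχ1 t x))
    · exact add_nonneg (Finset.sum_nonneg fun j _ => mul_nonneg (H.stopWeight_nonneg j x) (hχ0 j x))
        (mul_nonneg (H.survival_nonneg t x) (hχ0 t x))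
  have key : ∀ b : PathSp m T → ℝ, Measurable b → Integrable b P →
      ∫ z in S ×ˢ S', b z.1 ∂(stoppedCoupling P C θ) = ∫ x, W x * b x ∂P := by
    intro b hb hbi
    have hχb : ∀ j x, (S ×ˢ S').indicator (fun z : PathSp m T × PathSp m T => b z.1)
        (x, trunc j (codePath C x)) = χ j x * b x := fun j x => by
      by_cases hx : (x, trunc j (codePath C x)) ∈ S ×ˢ S'
      · simp only [hχ, Set.indicator_of_mem hx, one_mul]
      · simp only [hχ, Set.indicator_of_notMem hx, zero_mul]
    have hχm' : ∀ j, Measurable (χ j) := fun j =>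
      (measurable_const.indicator (hSm.prod hSm')).comp (H.measurable_graph j)
    have hχbi : ∀ j, Integrable (fun x => χ j x * b x) P := fun j =>
      integrable_weight_mul (hχm' j) (hχ0 j) (hχ1 j) hbi
    have hΦ : Measurable
        ((S ×ˢ S').indicator fun z : PathSp m T × PathSp m T => b z.1) :=
      (hb.comp measurable_fst).indicator (hSm.prod hSm')
    rw [← integral_indicator (hSm.prod hSm'), H.integral_stoppedCoupling_of_trunc ht hΦ]
    · simp only [hχb]
      have h1 : ∀ j ∈ Finset.range t, Integrable (fun x => stopWeight θ j x * (χ j x * b x)) P :=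
        fun j _ => integrable_weight_mul
          ((H.measurable_stopWeight (Nat.lt_succ_self j)).mono (ftr_le _) le_rfl)
          (H.stopWeight_nonneg j) (H.stopWeight_le_one j) (hχbi j)
      have h2 : Integrable (fun x => survival θ t x * (χ t x * b x)) P :=
        integrable_weight_mul ((H.measurable_survival t).mono (ftr_le _) le_rfl)
          (H.survival_nonneg t) (H.survival_le_one t) (hχbi t)
      rw [← integral_finsetSum _ h1, ← integral_add (integrable_finsetSum _ h1) h2]
      refine integral_congr_ae (Filter.Eventually.of_forall fun x => ?_)
      simp only [hW, add_mul, Finset.sum_mul, mul_assoc]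
    · intro j
      simp only [hχb]
      exact hχbi j
    · intro x y
      by_cases hx : x ∈ S ∧ y ∈ S'
      · rw [Set.indicator_of_mem, Set.indicator_of_mem] <;>
          simp [hx, trunc_mem_iff le_rfl hS']
      · rw [Set.indicator_of_notMem, Set.indicator_of_notMem] <;>
          simpa [trunc_mem_iff le_rfl hS'] using hx
  rw [key a ham hai, key _ hcm' integrable_condExp]
  exact integral_mul_condExp (ftr_le t) hWm hWb hai

/-- One step of the transition operator of the code process. -/
lemma exists_transition_step (H : IsThinnedCode P C θ) {t : ℕ} (ht : t + 1 < T)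
    {h : PathSp m T → ℝ} (hm : Measurable h) {B : ℝ} (hB : ∀ y, |h y| ≤ B) :
    ∃ G : PathSp m T → ℝ, Measurable G ∧ (∃ B', ∀ y, |G y| ≤ B') ∧
      ∀ S S', MeasurableSet[ftr m T (t + 1)] S → MeasurableSet[ftr m T (t + 1)] S' →
        ∫ z in S ×ˢ S', h (trunc (t + 2) z.2) ∂(stoppedCoupling P C θ) =
          ∫ z in S ×ˢ S', G (trunc (t + 1) z.2) ∂(stoppedCoupling P C θ) := by
  classical
  have hB0 : 0 ≤ B := (abs_nonneg _).trans (hB 0)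
  obtain ⟨r, hrm, hr1, hr⟩ := H.transition t ht
  set K : Finset (Fin m → ℝ) := (H.finite_range (t + 1)).toFinset with hK
  have hCK : ∀ x, C (t + 1) x ∈ K := fun x => by simp [hK]
  set s : Fin T := ⟨t, by omega⟩ with hs
  set s' : Fin T := ⟨t + 1, ht⟩ with hs'
  set d : (Fin m → ℝ) → PathSp m T → ℝ := fun k y => h (Function.update y s' k) - h y with hd
  have hdm : ∀ k, Measurable (d k) := fun k =>
    (hm.comp (measurable_update_left)).sub hm
  have hdb : ∀ k y, |d k y| ≤ 2 * B := fun k y => by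
    refine (abs_sub _ _).trans ?_
    linarith [hB y, hB (Function.update y s' k)]
  set G : PathSp m T → ℝ := fun y => h y + if y s = 0 then 0 else ∑ k ∈ K, r k (y s) * d k y
    with hG
  have hGm : Measurable G := by
    refine hm.add (Measurable.ite ?_ measurable_const ?_)
    · exact measurable_pi_apply s (measurableSet_singleton 0)
    · exact Finset.measurable_fun_sum _ fun k _ =>
        ((hrm k).comp (measurable_pi_apply s)).mul (hdm k)
  have hGb : ∀ y, |G y| ≤ B + ∑ k ∈ K, 1 * (2 * B) := fun y => by
    refine (abs_add_le _ _).trans (add_le_add (hB y) ?_)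
    split_ifs
    · simp only [abs_zero]; positivity
    · refine (Finset.abs_sum_le_sum_abs _ _).trans (Finset.sum_le_sum fun k _ => ?_)
      rw [abs_mul]
      exact mul_le_mul (hr1 _ _) (hdb _ _) (abs_nonneg _) zero_le_one
  refine ⟨G, hGm, ⟨_, hGb⟩, fun S S' hS hS' => ?_⟩
  have hSm := ftr_le _ _ hS
  have hSm' := ftr_le _ _ hS'
  set χ : PathSp m T × PathSp m T → ℝ := (S ×ˢ S').indicator fun _ => 1 with hχ
  have hχm : Measurable χ := measurable_const.indicator (hSm.prod hSm')
  have hχ0 : ∀ z, 0 ≤ χ z := fun z => Set.indicator_nonneg (fun _ _ => zero_le_one) _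
  have hχ1 : ∀ z, χ z ≤ 1 := fun z => Set.indicator_le_self' (fun _ _ => zero_le_one) _
  have hχtr : ∀ n, t + 1 ≤ n → ∀ x y, χ (x, trunc n y) = χ (x, y) := fun n hn x y => by
    by_cases hx : x ∈ S ∧ y ∈ S'
    · rw [hχ, Set.indicator_of_mem, Set.indicator_of_mem] <;>
        simp [hx, trunc_mem_iff hn hS']
    · rw [hχ, Set.indicator_of_notMem, Set.indicator_of_notMem] <;>
        simpa [trunc_mem_iff hn hS'] using hx
  have hind : ∀ u : PathSp m T → ℝ, ∫ z in S ×ˢ S', u z.2 ∂(stoppedCoupling P C θ) =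
      ∫ z, χ z * u z.2 ∂(stoppedCoupling P C θ) := fun u => by
    rw [← integral_indicator (hSm.prod hSm')]
    refine integral_congr_ae (Filter.Eventually.of_forall fun z => ?_)
    by_cases hz : z ∈ S ×ˢ S'
    · simp only [hχ, Set.indicator_of_mem hz, one_mul]
    · simp only [hχ, Set.indicator_of_notMem hz, zero_mul]
  have hexp : ∀ n, t + 1 ≤ n → n ≤ T → ∀ u : PathSp m T → ℝ, Measurable u →
      (∃ b, ∀ y, |u y| ≤ b) → (∀ y, u (trunc n y) = u y) →
      (∀ j, Integrable (fun x => χ (x, trunc j (codePath C x)) * u (trunc j (codePath C x))) P) ∧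
      ∫ z in S ×ˢ S', u z.2 ∂(stoppedCoupling P C θ) =
      ∑ j ∈ Finset.range n, ∫ x, stopWeight θ j x *
        (χ (x, trunc j (codePath C x)) * u (trunc j (codePath C x))) ∂P +
      ∫ x, survival θ n x *
        (χ (x, trunc n (codePath C x)) * u (trunc n (codePath C x))) ∂P := by
    rintro n hn hnT u hu ⟨b, hb⟩ hutr
    have hΦ : Measurable fun z : PathSp m T × PathSp m T => χ z * u z.2 :=
      hχm.mul (hu.comp measurable_snd)
    have hi : ∀ j, Integrable
        (fun x => χ (x, trunc j (codePath C x)) * u (trunc j (codePath C x))) P := fun j =>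
      Integrable.of_bound (hΦ.comp (H.measurable_graph j)).aestronglyMeasurable b
        (Filter.Eventually.of_forall fun x => by
          rw [Real.norm_eq_abs, abs_mul, abs_of_nonneg (hχ0 _)]
          exact (mul_le_of_le_one_left (abs_nonneg _) (hχ1 _)).trans (hb _))
    refine ⟨hi, ?_⟩
    rw [hind]
    exact H.integral_stoppedCoupling_of_trunc hnT hΦ hi fun x y => by
      simp only [hχtr n hn, hutr]
  obtain ⟨hi1, he1⟩ := hexp (t + 2) (by omega) (by omega) (fun y => h (trunc (t + 2) y))
    (hm.comp (measurable_trunc _)) ⟨B, fun y => hB _⟩ fun y => by simp [trunc_trunc]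
  obtain ⟨hi2, he2⟩ := hexp (t + 1) le_rfl (by omega) (fun y => G (trunc (t + 1) y))
    (hGm.comp (measurable_trunc _)) ⟨_, fun y => hGb _⟩ fun y => by simp [trunc_trunc]
  rw [he1, he2, Finset.sum_range_succ, add_assoc]
  congr 1
  · refine Finset.sum_congr rfl fun j hj => ?_
    have hj' : j ≤ t := Nat.lt_succ_iff.1 (Finset.mem_range.1 hj)
    have h1 : ∀ x, G (trunc j (codePath C x)) = h (trunc j (codePath C x)) := fun x => by
      have : trunc j (codePath C x) s = 0 := by simp [trunc, hs, hj']
      simp [hG, this]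
    simp only [trunc_trunc, min_eq_right (show j ≤ t + 2 by omega),
      min_eq_right (show j ≤ t + 1 by omega), h1]
  · simp only [trunc_trunc, min_self, min_eq_right (show t + 1 ≤ t + 2 by omega)]
    set Y : PathSp m T → PathSp m T := fun x => trunc (t + 1) (codePath C x) with hY
    have hYm : Measurable[ftr m T (t + 1)] Y := H.measurable_trunc_codePath le_rfl
    have hYs : ∀ x, Y x s = C t x := fun x => by simp [hY, trunc, hs, codePath]
    have hY2 : ∀ x, trunc (t + 2) (codePath C x) = Function.update (Y x) s' (C (t + 1) x) :=
      fun x => trunc_succ ht _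
    set ψ : PathSp m T → ℝ := fun x => survival θ (t + 1) x * χ (x, Y x) with hψ
    have hψm : Measurable[ftr m T (t + 1)] ψ := by
      refine (H.measurable_survival _).mul ?_
      have h1 : MeasurableSet[ftr m T (t + 1)] (S ∩ Y ⁻¹' S') := by
        refine hS.inter ?_
        obtain ⟨S'', hS'', rfl⟩ := hS'
        exact (measurable_trunc (t + 1)).comp hYm hS''
      exact (measurable_const (a := (1 : ℝ))).indicator h1
    have hψb : ∀ x, |ψ x| ≤ 1 := fun x => by
      rw [abs_of_nonneg (mul_nonneg (H.survival_nonneg _ x) (hχ0 _))]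
      exact mul_le_one₀ (H.survival_le_one _ x) (hχ0 _) (hχ1 _)
    have hZm : ∀ k, Measurable[ftr m T (t + 1)] fun x => ψ x * d k (Y x) := fun k =>
      hψm.mul ((hdm k).comp hYm)
    have hZb : ∀ k x, |ψ x * d k (Y x)| ≤ 1 * (2 * B) := fun k x => by
      rw [abs_mul]
      exact mul_le_mul (hψb x) (hdb _ _) (abs_nonneg _) zero_le_one
    have hθi : ∀ k, Integrable ((C (t + 1) ⁻¹' {k}).indicator (θ (t + 1))) P := fun k => by
      refine Integrable.indicator ?_ (((H.measurable_code (t + 1)).mono (ftr_le _) le_rfl)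
        (measurableSet_singleton k))
      exact Integrable.of_bound
        ((H.measurable_accept (t + 1)).mono (ftr_le _) le_rfl).aestronglyMeasurable 1
        (Filter.Eventually.of_forall fun x => by
          rw [Real.norm_eq_abs, abs_of_nonneg (H.nonneg _ x)]; exact H.le_one _ x)
    have hZθ : ∀ k ∈ K, ∫ x, (ψ x * d k (Y x)) * (C (t + 1) ⁻¹' {k}).indicator (θ (t + 1)) x ∂P =
        ∫ x, (ψ x * d k (Y x)) * r k (C t x) ∂P := fun k hk => by
      rw [← integral_mul_condExp (ftr_le (t + 1)) (hZm k) (hZb k) (hθi k)]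
      have hk' : k ∈ Set.range (C (t + 1)) := by simpa [hK] using hk
      exact integral_congr_ae ((hr k hk').mono fun x hx => by simp only [hx])
    have hZi : ∀ k, ∀ f : PathSp m T → ℝ, Integrable f P →
        Integrable (fun x => (ψ x * d k (Y x)) * f x) P := fun k f hf =>
      hf.bdd_mul ((hZm k).mono (ftr_le _) le_rfl).aestronglyMeasurable
        (Filter.Eventually.of_forall (hZb k))
    have hri : ∀ k, Integrable (fun x => r k (C t x)) P := fun k =>
      Integrable.of_bound ((hrm k).comp
        ((H.measurable_code t).mono (ftr_le _) le_rfl)).aestronglyMeasurable 1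
        (Filter.Eventually.of_forall fun x => hr1 _ _)
    have hψh : Integrable (fun x => ψ x * h (Y x)) P := by
      refine Integrable.of_bound ((hψm.mul (hm.comp hYm)).mono (ftr_le _)
        le_rfl).aestronglyMeasurable (1 * B) (Filter.Eventually.of_forall fun x => ?_)
      rw [Real.norm_eq_abs, abs_mul]
      exact mul_le_mul (hψb x) (hB _) (abs_nonneg _) zero_le_one
    rw [← integral_add]
    · calc _ = ∫ x, (ψ x * h (Y x) + ∑ k ∈ K,
            (ψ x * d k (Y x)) * (C (t + 1) ⁻¹' {k}).indicator (θ (t + 1)) x) ∂P := by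
            refine integral_congr_ae (Filter.Eventually.of_forall fun x => ?_)
            have h1 : χ (x, Function.update (Y x) s' (C (t + 1) x)) = χ (x, Y x) := by
              rw [← hY2, hχtr _ (by omega), hY]; exact (hχtr _ le_rfl _ _).symm
            have h2 : ∑ k ∈ K, (ψ x * d k (Y x)) * (C (t + 1) ⁻¹' {k}).indicator (θ (t + 1)) x
                = (ψ x * d (C (t + 1) x) (Y x)) * θ (t + 1) x := by
              rw [Finset.sum_eq_single_of_mem _ (hCK x)]
              · simp
              · intro k _ hk
                simp [Ne.symm hk]
            simp only [hY2, h1, h2]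
            simp only [hψ, hd, stopWeight, survival, Finset.prod_range_succ]
            ring
        _ = ∫ x, (ψ x * h (Y x) + ∑ k ∈ K, (ψ x * d k (Y x)) * r k (C t x)) ∂P := by
            rw [integral_add hψh (integrable_finsetSum _ fun k _ => hZi k _ (hθi k)),
              integral_add hψh (integrable_finsetSum _ fun k _ => hZi k _ (hri k)),
              integral_finsetSum _ fun k _ => hZi k _ (hθi k),
              integral_finsetSum _ fun k _ => hZi k _ (hri k), Finset.sum_congr rfl hZθ]
        _ = _ := by
            refine integral_congr_ae (Filter.Eventually.of_forall fun x => ?_)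
            have h1 : Y x s ≠ 0 := by rw [hYs]; exact H.code_ne_zero t (by omega) x
            have h2 : G (Y x) = h (Y x) + ∑ k ∈ K, r k (C t x) * d k (Y x) := by
              simp only [hG]
              rw [if_neg h1, hYs]
            change _ = survival θ (t + 1) x * (χ (x, Y x) * G (Y x))
            rw [h2, ← mul_assoc, mul_add, Finset.mul_sum]
            exact congrArg _ (Finset.sum_congr rfl fun k _ => by ring)
    · have h1 := hi1 (t + 1)
      simp only [trunc_trunc, min_eq_right (show t + 1 ≤ t + 2 by omega)] at h1
      exact integrable_weight_mul
        ((H.measurable_stopWeight (Nat.lt_succ_self _)).mono (ftr_le _) le_rfl)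
        (H.stopWeight_nonneg _) (H.stopWeight_le_one _) h1
    · have h1 := hi1 (t + 2)
      simp only [trunc_trunc, min_self] at h1
      exact integrable_weight_mul ((H.measurable_survival _).mono (ftr_le _) le_rfl)
        (H.survival_nonneg _) (H.survival_le_one _) h1

/-- Given the past of the code, the past of the path carries no information on the code. -/
lemma exists_transition (H : IsThinnedCode P C θ) {g : PathSp m T → ℝ} (hm : Measurable g) {b : ℝ}
    (hb : ∀ y, |g y| ≤ b) {t : ℕ} (ht : t ≤ T) (ht1 : 1 ≤ t) :
    ∃ G : PathSp m T → ℝ, Measurable G ∧ (∃ b', ∀ y, |G y| ≤ b') ∧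
      ∀ S S', MeasurableSet[ftr m T t] S → MeasurableSet[ftr m T t] S' →
        ∫ z in S ×ˢ S', g z.2 ∂(stoppedCoupling P C θ) =
          ∫ z in S ×ˢ S', G (trunc t z.2) ∂(stoppedCoupling P C θ) := by
  induction ht using Nat.decreasingInduction with
  | self => exact ⟨g, hm, ⟨b, hb⟩, fun S S' _ _ => by simp only [trunc_eq_self le_rfl]⟩
  | of_succ t ht ih =>
    obtain ⟨h, hhm, ⟨b', hb'⟩, hh⟩ := ih (by omega)
    obtain ⟨t, rfl⟩ := Nat.exists_eq_add_of_le' ht1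
    obtain ⟨G, hGm, hGb, hG⟩ := H.exists_transition_step ht hhm hb'
    exact ⟨G, hGm, hGb, fun S S' hS hS' =>
      (hh S S' (ftr_mono (by omega) S hS) (ftr_mono (by omega) S' hS')).trans (hG S S' hS hS')⟩

/-- The coupling is causal from the code to the path. -/
lemma condExp_snd_stoppedCoupling (H : IsThinnedCode P C θ) {t : ℕ} (ht1 : 1 ≤ t) (ht : t ≤ T)
    {A : Set (PathSp m T)} (hA : MeasurableSet A) :
    (stoppedCoupling P C θ)[((Set.univ : Set (PathSp m T)) ×ˢ A).indicator (fun _ => (1 : ℝ)) |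
        (ftr m T t).prod (ftr m T t)]
      =ᵐ[stoppedCoupling P C θ] fun z => (((stoppedCoupling P C θ).map Prod.snd)[
        A.indicator (fun _ => (1 : ℝ)) | ftr m T t]) z.2 := by
  have := H.isProbabilityMeasure_stoppedCoupling
  have : IsProbabilityMeasure ((stoppedCoupling P C θ).map Prod.snd) :=
    Measure.isProbabilityMeasure_map measurable_snd.aemeasurable
  set a : PathSp m T → ℝ := A.indicator fun _ => 1 with ha
  have ham : Measurable a := measurable_const.indicator hA
  have hab : ∀ y, |a y| ≤ 1 := fun y => by
    by_cases hy : y ∈ A <;> simp [ha, hy]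
  obtain ⟨G, hGm, ⟨b, hb⟩, hG⟩ := H.exists_transition ham hab ht ht1
  have hsnd : ((Set.univ : Set (PathSp m T)) ×ˢ A).indicator (fun _ => (1 : ℝ))
      = fun z => a z.2 := by
    ext z
    by_cases hz : z.2 ∈ A <;> simp [ha, hz]
  have hgm : Measurable[ftr m T t] fun y => G (trunc t y) := hGm.comp (measurable_ftr_trunc t)
  have hgm' : Measurable fun y : PathSp m T => G (trunc t y) := hGm.comp (measurable_trunc t)
  have hint : ∀ u : PathSp m T → ℝ, Measurable u → (∃ b, ∀ y, |u y| ≤ b) →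
      Integrable (fun z : PathSp m T × PathSp m T => u z.2) (stoppedCoupling P C θ) :=
    fun u hu ⟨b, hb⟩ => Integrable.of_bound (hu.comp measurable_snd).aestronglyMeasurable b
      (Filter.Eventually.of_forall fun z => hb z.2)
  have hint' : ∀ u : PathSp m T → ℝ, Measurable u → (∃ b, ∀ y, |u y| ≤ b) →
      Integrable u ((stoppedCoupling P C θ).map Prod.snd) :=
    fun u hu ⟨b, hb⟩ => Integrable.of_bound hu.aestronglyMeasurable b
      (Filter.Eventually.of_forall hb)
  have h1 : (stoppedCoupling P C θ)[fun z => a z.2 | (ftr m T t).prod (ftr m T t)]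
      =ᵐ[stoppedCoupling P C θ] fun z => G (trunc t z.2) :=
    condExp_prod_ae_eq (ftr_le t) (ftr_le t) (hint a ham ⟨1, hab⟩)
      (hint _ hgm' ⟨b, fun y => hb _⟩) (hgm.comp (@measurable_snd _ _ (ftr m T t) (ftr m T t)))
      fun S S' hS hS' => (hG S S' hS hS').symm
  have h2 : (fun y => G (trunc t y)) =ᵐ[(stoppedCoupling P C θ).map Prod.snd]
      ((stoppedCoupling P C θ).map Prod.snd)[a | ftr m T t] := by
    refine ae_eq_condExp_of_forall_setIntegral_eq (ftr_le t) (hint' a ham ⟨1, hab⟩)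
      (fun s _ _ => (hint' _ hgm' ⟨b, fun y => hb _⟩).integrableOn) ?_
      hgm.stronglyMeasurable.aestronglyMeasurable
    intro S' hS' _
    rw [setIntegral_map (ftr_le t _ hS') hgm'.aestronglyMeasurable measurable_snd.aemeasurable,
      setIntegral_map (ftr_le t _ hS') ham.aestronglyMeasurable measurable_snd.aemeasurable,
      ← Set.univ_prod]
    exact (hG Set.univ S' MeasurableSet.univ hS').symm
  rw [hsnd]
  exact h1.trans (ae_of_ae_map measurable_snd.aemeasurable h2)

lemma isNestedCoupling_stoppedCoupling (H : IsThinnedCode P C θ) :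
    IsNestedCoupling P ((stoppedCoupling P C θ).map Prod.snd) (stoppedCoupling P C θ) :=
  ⟨H.isProbabilityMeasure_stoppedCoupling, H.map_fst_stoppedCoupling, rfl,
    fun _ ht1 ht _ hA => ⟨H.condExp_fst_stoppedCoupling ht hA,
      H.condExp_snd_stoppedCoupling ht1 ht hA⟩⟩

lemma integral_pathDist_le (H : IsThinnedCode P C θ) {R η δ : ℝ} (hR : 0 ≤ R) (hη : 0 ≤ η)
    (hbd : ∀ᵐ x ∂P, ∀ s, dist (x s) 0 ≤ R)
    (hC : ∀ᵐ x ∂P, ∀ s : Fin T, dist (x s) (C s x) ≤ η)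
    (hθ : ∀ t < T, 1 - δ ≤ ∫ x, θ t x ∂P) :
    ∫ z, pathDist z.1 z.2 ∂(stoppedCoupling P C θ) ≤ T * η + T * δ * (T * R) := by
  have hpm : Measurable fun z : PathSp m T × PathSp m T => pathDist z.1 z.2 :=
    Finset.measurable_fun_sum _ fun s _ =>
      ((measurable_pi_apply s).comp measurable_fst).dist
        ((measurable_pi_apply s).comp measurable_snd)
  have hp0 : ∀ x y : PathSp m T, 0 ≤ pathDist x y := fun x y =>
    Finset.sum_nonneg fun s _ => dist_nonneg
  have hle : ∀ᵐ x ∂P, ∀ j, pathDist x (trunc j (codePath C x)) ≤ T * (η + R) := by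
    filter_upwards [hbd, hC] with x hx hx' j
    refine (Finset.sum_le_card_nsmul _ _ (η + R) fun s _ => ?_).trans (by simp [mul_add])
    by_cases hs : (s : ℕ) < j
    · simpa [trunc, hs, codePath] using (hx' s).trans (by linarith)
    · simpa [trunc, hs] using (hx s).trans (by linarith)
  have hleT : ∀ᵐ x ∂P, pathDist x (trunc T (codePath C x)) ≤ T * η := by
    filter_upwards [hC] with x hx'
    rw [trunc_eq_self le_rfl]
    exact (Finset.sum_le_card_nsmul _ _ η fun s _ => hx' s).trans (by simp)
  have hwm : ∀ j, Measurable (stopWeight θ j) := fun j =>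
    (H.measurable_stopWeight (Nat.lt_succ_self j)).mono (ftr_le _) le_rfl
  have hθi : ∀ t, Integrable (θ t) P := fun t => Integrable.of_bound
    ((H.measurable_accept t).mono (ftr_le _) le_rfl).aestronglyMeasurable 1
    (Filter.Eventually.of_forall fun x => by
      rw [Real.norm_eq_abs, abs_of_nonneg (H.nonneg t x)]; exact H.le_one t x)
  have hint : ∀ j, Integrable (fun x => pathDist x (trunc j (codePath C x))) P := fun j =>
    Integrable.of_bound (hpm.comp (H.measurable_graph j)).aestronglyMeasurable (T * (η + R))
      (hle.mono fun x hx => by rw [Real.norm_eq_abs, abs_of_nonneg (hp0 _ _)]; exact hx j)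
  rw [(H.integral_stoppedCoupling hpm hint).2, ← integral_finsetSum _ fun j _ =>
    integrable_weight_mul (hwm j) (H.stopWeight_nonneg j) (H.stopWeight_le_one j) (hint j)]
  have hsi : Integrable (fun x => ∑ s ∈ Finset.range T, (1 - θ s x)) P :=
    integrable_finsetSum _ fun s _ => (integrable_const 1).sub (hθi s)
  calc _ ≤ ∫ x, (T * η + (∑ s ∈ Finset.range T, (1 - θ s x)) * (T * R)) ∂P := by
        refine integral_mono_ae (integrable_finsetSum _ fun j _ =>
          integrable_weight_mul (hwm j) (H.stopWeight_nonneg j) (H.stopWeight_le_one j) (hint j))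
          ((integrable_const _).add (hsi.mul_const _)) ?_
        filter_upwards [hle, hleT] with x hx hxT
        have h1 : ∑ j ∈ Finset.range T, stopWeight θ j x = 1 - survival θ T x := by
          rw [Finset.range_eq_Ico, sum_Ico_stopWeight θ x (Nat.zero_le T)]
          simp [survival]
        have h2 : stopWeight θ T x = survival θ T x := by simp [stopWeight, H.accept_last]
        rw [Finset.sum_range_succ, h2]
        have h3 : ∑ j ∈ Finset.range T, stopWeight θ j x * pathDist x (trunc j (codePath C x)) ≤
            (1 - survival θ T x) * (T * (η + R)) := by
          rw [← h1, Finset.sum_mul]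
          exact Finset.sum_le_sum fun j _ =>
            mul_le_mul_of_nonneg_left (hx j) (H.stopWeight_nonneg j x)
        have h4 := mul_le_mul_of_nonneg_left hxT (H.survival_nonneg T x)
        have h5 := mul_le_mul_of_nonneg_right (H.one_sub_survival_le T x)
          (show (0 : ℝ) ≤ T * R by positivity)
        linarith
    _ = T * η + (∑ s ∈ Finset.range T, (1 - ∫ x, θ s x ∂P)) * (T * R) := by
        rw [integral_add (integrable_const _) (hsi.mul_const _), integral_const, integral_mul_const,
          integral_finsetSum (f := fun s x => 1 - θ s x) _
            fun s _ => (integrable_const 1).sub (hθi s)]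
        simp [integral_sub (integrable_const (1 : ℝ)) (hθi _)]
    _ ≤ T * η + T * δ * (T * R) := by
        gcongr
        refine (Finset.sum_le_card_nsmul _ _ δ fun s hs => ?_).trans (by simp)
        linarith [hθ s (Finset.mem_range.1 hs)]

end IsThinnedCode

/-- Almost surely bounded processes admit thinned codes of arbitrary precision, which are accepted
with probability arbitrarily close to one. -/
lemma exists_isThinnedCode (P : Measure (PathSp m T)) [IsProbabilityMeasure P] (i₀ : Fin m)
    (hT : 0 < T) {R : ℝ} (hbd : ∀ᵐ x ∂P, ∀ s, dist (x s) 0 ≤ R) {η δ : ℝ} (hη : 0 < η)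
    (hδ : 0 < δ) :
    ∃ C θ, IsThinnedCode P C θ ∧ (∀ᵐ x ∂P, ∀ s : Fin T, dist (x s) (C s x) ≤ η) ∧
      ∀ t < T, 1 - δ ≤ ∫ x, θ t x ∂P := by
  have key : ∀ n, ∃ C : ℕ → PathSp m T → Fin m → ℝ,
      (∀ t, Measurable[ftr m T (t + 1)] (C t)) ∧ (∀ t, (Set.range (C t)).Finite) ∧
      ∀ t (ht : t < T), T ≤ t + n → (∀ x, C t x ≠ 0) ∧
        (∀ᵐ x ∂P, dist (x ⟨t, ht⟩) (C t x) ≤ η) ∧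
        ∃ (θ : PathSp m T → ℝ) (r : (Fin m → ℝ) → (Fin m → ℝ) → ℝ),
          Measurable[ftr m T (t + 2)] θ ∧ (∀ x, 0 ≤ θ x) ∧ (∀ x, θ x ≤ 1) ∧
          1 - δ ≤ ∫ x, θ x ∂P ∧ (∀ k, Measurable (r k)) ∧ (∀ k c, |r k c| ≤ 1) ∧
          ∀ k ∈ Set.range (C (t + 1)),
            P[(C (t + 1) ⁻¹' {k}).indicator θ | ftr m T (t + 1)] =ᵐ[P] fun x => r k (C t x) := by
    intro n
    induction n with
    | zero => exact ⟨fun _ _ => 0, fun t => measurable_const,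
        fun t => (Set.finite_singleton 0).subset (by rintro _ ⟨x, rfl⟩; rfl),
        fun t ht h => absurd h (by omega)⟩
    | succ n ih =>
      obtain ⟨C, hCm, hCf, hC⟩ := ih
      by_cases hn : n < T
      · obtain ⟨t, ht⟩ : ∃ t, T = t + n + 1 := ⟨T - n - 1, by omega⟩
        have htT : t < T := by omega
        set f : PathSp m T → Fin m → ℝ :=
          fun x => if dist (x ⟨t, htT⟩) 0 ≤ R then x ⟨t, htT⟩ else 0 with hf
        have hfm : Measurable[ftr m T (t + 1)] f := by
          have hx := measurable_ftr_apply (m := m) (t := t + 1) ⟨t, htT⟩ (Nat.lt_succ_self t)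
          have hcl : Measurable fun y : Fin m → ℝ => if dist y 0 ≤ R then y else 0 :=
            Measurable.ite (measurableSet_le (measurable_id.dist measurable_const) measurable_const)
              measurable_id measurable_const
          exact hcl.comp hx
        have hfR : ∀ x i, |f x i| ≤ max R 0 := fun x i => by
          by_cases h : dist (x ⟨t, htT⟩) 0 ≤ R
          · simp only [hf, if_pos h]
            have h1 := (dist_le_pi_dist (x ⟨t, htT⟩) 0 i).trans h
            rw [Pi.zero_apply, Real.dist_eq, sub_zero] at h1
            exact h1.trans (le_max_left _ _)
          · simp only [hf, if_neg h, Pi.zero_apply, abs_zero]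
            exact le_max_right _ _
        obtain ⟨c, θ, r, hcm, hcf, hc0, hcd, hθr⟩ := exists_code_thinning (ftr_le (t + 1)) P i₀ hfm
          hfR (ftr_mono (Nat.le_succ (t + 1))) (ftr_le (t + 2)) (hCm (t + 1)) (hCf (t + 1)) hη hδ
        have hcu : ∀ s, s ≠ t → Function.update C t c s = C s := fun s hs =>
          Function.update_of_ne hs _ _
        refine ⟨Function.update C t c, fun s => ?_, fun s => ?_, fun s hs hsn => ?_⟩
        · by_cases h : s = t
          · subst h; simpa using hcm
          · rw [hcu s h]; exact hCm s
        · by_cases h : s = t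
          · subst h; simpa using hcf
          · rw [hcu s h]; exact hCf s
        · by_cases h : s = t
          · subst h
            rw [Function.update_self, hcu (s + 1) (by omega)]
            refine ⟨hc0, ?_, θ, r, hθr⟩
            filter_upwards [hbd] with x hx
            have h1 := hcd x
            simp only [hf, if_pos (hx ⟨s, hs⟩)] at h1
            rwa [dist_comm]
          · rw [hcu s h, hcu (s + 1) (by omega)]
            exact hC s hs (by omega)
      · exact ⟨C, hCm, hCf, fun t ht h => hC t ht (by omega)⟩
  obtain ⟨C, hCm, hCf, hC⟩ := key T
  have hCT := fun t ht => hC t ht (Nat.le_add_left T t)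
  choose! θ r hθm hθ0 hθ1 hθδ hr using fun t ht => (hCT t ht).2.2
  set Θ : ℕ → PathSp m T → ℝ := fun t x =>
    if t = 0 then 1 else if t < T then θ (t - 1) x else 0 with hΘ
  have hΘ_zero : Θ 0 = fun _ => 1 := by simp [hΘ]
  have hΘ_succ : ∀ t, t + 1 < T → Θ (t + 1) = θ t := fun t ht => by simp [hΘ, ht]
  have hΘ_ge : ∀ t, T ≤ t → Θ t = fun _ => 0 := fun t ht => by
    simp [hΘ, ht.not_gt, (hT.trans_le ht).ne']
  have hcases : ∀ p : ℕ → (PathSp m T → ℝ) → Prop, p 0 (fun _ => 1) →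
      (∀ t, t + 1 < T → p (t + 1) (θ t)) → (∀ t, T ≤ t → p t fun _ => 0) → ∀ t, p t (Θ t) := by
    intro p h0 hs hge t
    rcases lt_or_ge t T with ht | ht
    · cases t with
      | zero => rwa [hΘ_zero]
      | succ t => rw [hΘ_succ t ht]; exact hs t ht
    · rw [hΘ_ge t ht]; exact hge t ht
  refine ⟨C, Θ, ⟨hCm, hCf, fun t ht => (hCT t ht).1, ?_, ?_, ?_, ?_, ?_⟩, ?_, ?_⟩
  · exact hcases (fun t u => Measurable[ftr m T (t + 1)] u) measurable_const
      (fun t ht => hθm t (by omega)) fun _ _ => measurable_const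
  · exact hcases (fun _ u => ∀ x, 0 ≤ u x) (fun _ => zero_le_one)
      (fun t ht => hθ0 t (by omega)) fun _ _ _ => le_rfl
  · exact hcases (fun _ u => ∀ x, u x ≤ 1) (fun _ => le_rfl)
      (fun t ht => hθ1 t (by omega)) fun _ _ _ => zero_le_one
  · exact fun x => congrFun (hΘ_ge T le_rfl) x
  · intro t ht
    rw [hΘ_succ t ht]
    exact ⟨r t, hr t (by omega)⟩
  · exact ae_all_iff.2 fun s => (hCT s s.isLt).2.1
  · exact hcases (fun t u => t < T → 1 - δ ≤ ∫ x, u x ∂P) (fun _ => by simpa using hδ.le)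
      (fun t ht _ => hθδ t (by omega)) fun t h h' => absurd h' h.not_gt

end StoppedCoupling

section NestedDistance

variable {m T : ℕ}

lemma integral_pathDist_nonneg (π : Measure (PathSp m T × PathSp m T)) :
    0 ≤ ∫ z, pathDist z.1 z.2 ∂π :=
  integral_nonneg fun _ => Finset.sum_nonneg fun _ _ => dist_nonneg

lemma IsNestedCoupling.nestedDist_le {P P' : Measure (PathSp m T)}
    {π : Measure (PathSp m T × PathSp m T)} (h : IsNestedCoupling P P' π) :
    nestedDist P P' ≤ ∫ z, pathDist z.1 z.2 ∂π := by
  refine csInf_le ⟨0, ?_⟩ ⟨π, h, rfl⟩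
  rintro _ ⟨π', -, rfl⟩
  exact integral_pathDist_nonneg π'

lemma nestedDist_eq_zero_of_subsingleton [Subsingleton (PathSp m T)] (P P' : Measure (PathSp m T)) :
    nestedDist P P' = 0 := by
  have h : ∀ x y : PathSp m T, pathDist x y = 0 := fun x y => by
    simp [Subsingleton.elim x y, pathDist]
  refine le_antisymm (Real.sInf_nonpos ?_) (Real.sInf_nonneg ?_)
  all_goals
    rintro _ ⟨π, -, rfl⟩
    simp [h]

end NestedDistance

/-- Theorem B of the paper's appendix. A process on a compact product
support whose conditional distributions are Lipschitz in the Wasserstein distance can be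
approximated arbitrarily well, in the nested distance, by a finitely supported model
(a finite scenario tree). -/
theorem exists_finite_tree_approximation
    {m T : ℕ} (P : Measure (PathSp m T)) [IsProbabilityMeasure P]
    -- compact product support D = D₁ × … × D_T
    (D : Fin T → Set (Fin m → ℝ)) (hDcpt : ∀ t, IsCompact (D t))
    (hsupp : P {ξ | ∀ t, ξ t ∈ D t} = 1)
    -- Lipschitz property of the conditional distributions on D
    (γ : ℕ → ℝ) (hγ : ∀ t < T, 0 < γ t)
    (hLip : ∀ (t : ℕ) (ht : t < T), ∀ x y : Fin t → Fin m → ℝ,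
      (∀ s : Fin t, x s ∈ D ⟨(s : ℕ), lt_trans s.isLt ht⟩) →
      (∀ s : Fin t, y s ∈ D ⟨(s : ℕ), lt_trans s.isLt ht⟩) →
      wdist (condK P t ht x) (condK P t ht y) ≤ γ t * dist x y) :
    ∀ ε : ℝ, 0 < ε → ∃ P' : Measure (PathSp m T), IsProbabilityMeasure P' ∧
      (∃ s : Finset (PathSp m T), P' (↑s)ᶜ = 0) ∧ nestedDist P P' ≤ ε := by
  intro ε hε
  have hbound : ∃ R, 0 ≤ R ∧ ∀ t, ∀ y ∈ D t, dist y 0 ≤ R := by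
    choose R hR using fun t => (hDcpt t).isBounded.subset_closedBall 0
    refine ⟨∑ t, |R t|, Finset.sum_nonneg fun t _ => abs_nonneg _, fun t y hy => ?_⟩
    exact (hR t hy).trans ((le_abs_self _).trans
      (Finset.single_le_sum (f := fun t => |R t|) (fun t _ => abs_nonneg _) (Finset.mem_univ t)))
  obtain ⟨R, hR0, hR⟩ := hbound
  have hmeas : MeasurableSet {ξ : PathSp m T | ∀ t, ξ t ∈ D t} := by
    rw [Set.ofPred_forall]
    exact MeasurableSet.iInter fun t => measurable_pi_apply t (hDcpt t).measurableSet
  have hbd : ∀ᵐ x ∂P, ∀ s, dist (x s) 0 ≤ R := by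
    have h : ∀ᵐ x ∂P, ∀ t, x t ∈ D t := (prob_compl_eq_zero_iff hmeas).2 hsupp
    exact h.mono fun x hx s => hR s _ (hx s)
  rcases subsingleton_or_nontrivial (PathSp m T) with hsub | hnon
  · refine ⟨P, inferInstance, ⟨{0}, ?_⟩, (nestedDist_eq_zero_of_subsingleton P P).trans_le hε.le⟩
    exact measure_mono_null (t := ∅) (fun x hx => hx (by simp [Subsingleton.elim x 0]))
      measure_empty
  obtain ⟨x, y, hxy⟩ := hnon
  obtain ⟨t₀, ht₀⟩ := Function.ne_iff.1 hxy
  obtain ⟨i₀, -⟩ := Function.ne_iff.1 ht₀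
  have hT : 0 < T := Fin.pos t₀
  have hη : 0 < ε / (2 * T) := by positivity
  have hδ : 0 < ε / (2 * T ^ 2 * (R + 1)) := by positivity
  obtain ⟨C, θ, H, hC, hθ⟩ := exists_isThinnedCode P i₀ hT hbd hη hδ
  have := H.isProbabilityMeasure_stoppedCoupling
  refine ⟨(stoppedCoupling P C θ).map Prod.snd,
    Measure.isProbabilityMeasure_map measurable_snd.aemeasurable,
    H.exists_finset_map_snd_stoppedCoupling, ?_⟩
  calc nestedDist P ((stoppedCoupling P C θ).map Prod.snd)
      ≤ ∫ z, pathDist z.1 z.2 ∂(stoppedCoupling P C θ) :=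
        H.isNestedCoupling_stoppedCoupling.nestedDist_le
    _ ≤ T * (ε / (2 * T)) + T * (ε / (2 * T ^ 2 * (R + 1))) * (T * R) :=
        H.integral_pathDist_le hR0 hη.le hbd hC hθ
    _ = ε / 2 + ε / 2 * (R / (R + 1)) := by field_simp
    _ ≤ ε / 2 + ε / 2 * 1 := by
        gcongr
        exact div_le_one_of_le₀ (by linarith) (by linarith)
    _ = ε := by ring

end
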